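/- For each x > 0 let u_x : [0, x] → ℝ be the strictly increasing solution of u'' = u², u(0) = 0, u(x) = 1, and suppose u_x(y) = 6·℘_{Λ_{ω_x}}(y + 2ω_x/3) where ω_x > 0 and Λ_ω = {m·(ω/√3)·e^{iπ/6} + n·(ω/√3)·e^{iπ/2} : m, n ∈ ℤ}. Set c₁ = ω₁/3, where ω₁ is the period corresponding to x = 1. Then for each fixed s ∈ (0, 1), lim_{x→∞} x²·u_x(s·x) = 6·c₁²·℘_{Λ_{ω₁}}(2ω₁/3 + s·c₁). -/

import Mathlib

open Set Filter

/-- The Weierstrass ℘-function of the lattice `Λ`. -/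
noncomputable def wp (Λ : Set ℂ) (z : ℂ) : ℂ :=
  1 / z ^ 2 + ∑' l : {l : ℂ // l ∈ Λ ∧ l ≠ 0}, (1 / (z - (l : ℂ)) ^ 2 - 1 / (l : ℂ) ^ 2)

/-- The lattice `Λ_ω` generated by `(ω/√3) e^{iπ/6}` and `(ω/√3) e^{iπ/2}`. -/
noncomputable def Lomega (ω : ℝ) : Set ℂ :=
  {z : ℂ | ∃ m n : ℤ,
    z = (m : ℂ) * (((ω / Real.sqrt 3 : ℝ) : ℂ) * Complex.exp ((Real.pi : ℂ) * Complex.I / 6)) +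
        (n : ℂ) * (((ω / Real.sqrt 3 : ℝ) : ℂ) * Complex.exp ((Real.pi : ℂ) * Complex.I / 2))}

open scoped Topology

namespace QHA

lemma exp6 : Complex.exp ((Real.pi : ℂ) * Complex.I / 6) = ((Real.sqrt 3 / 2 : ℝ) : ℂ) + ((1/2 : ℝ) : ℂ) * Complex.I := by
  have : (Real.pi : ℂ) * Complex.I / 6 = ((Real.pi / 6 : ℝ) : ℂ) * Complex.I := by push_cast; ring
  rw [this, Complex.exp_mul_I, ← Complex.ofReal_cos, ← Complex.ofReal_sin, Real.cos_pi_div_six,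
    Real.sin_pi_div_six]

lemma exp2 : Complex.exp ((Real.pi : ℂ) * Complex.I / 2) = Complex.I := by
  have : (Real.pi : ℂ) * Complex.I / 2 = (Real.pi / 2 : ℂ) * Complex.I := by ring
  rw [this, Complex.exp_pi_div_two_mul_I]

lemma s3 : Real.sqrt 3 ≠ 0 := by positivity

noncomputable def LL : PeriodPair where
  ω₁ := (((1 / Real.sqrt 3 : ℝ) : ℂ) * Complex.exp ((Real.pi : ℂ) * Complex.I / 6))
  ω₂ := (((1 / Real.sqrt 3 : ℝ) : ℂ) * Complex.exp ((Real.pi : ℂ) * Complex.I / 2))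
  indep := by
    rw [LinearIndependent.pair_iff]
    intro a b h
    rw [exp6, exp2] at h
    have h1 := congrArg Complex.re h
    have h2 := congrArg Complex.im h
    have := s3
    simp at h1 h2
    subst h1
    simpa using h2

lemma mem_LL (z : ℂ) : z ∈ LL.lattice ↔ z ∈ Lomega 1 := by
  rw [PeriodPair.mem_lattice]
  simp only [Lomega, LL, Set.mem_ofPred_eq, eq_comm]

lemma real_mem (t : ℝ) (h : (t : ℂ) ∈ Lomega 1) : ∃ k : ℤ, t = k := by
  obtain ⟨m, n, h⟩ := h
  rw [exp6, exp2] at h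
  have h1 := congrArg Complex.re h
  have h2 := congrArg Complex.im h
  have := s3
  simp at h1 h2
  field_simp at h1 h2
  refine ⟨-n, ?_⟩
  rw [Real.sq_sqrt (by norm_num)] at h1
  have h3 : (m : ℝ) + 2 * n = 0 := by
    rw [mul_zero] at h2
    exact (mul_eq_zero.1 h2.symm).resolve_left this
  push_cast
  linarith

lemma one_mem : (1 : ℂ) ∈ Lomega 1 := by
  refine ⟨2, -1, ?_⟩
  rw [exp6, exp2]
  have := s3
  apply Complex.ext
  · simp
    field_simp
    rw [Real.sq_sqrt (by norm_num)]
  · simp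
    ring

lemma wp_eq (z : ℂ) : wp (Lomega 1) z = LL.weierstrassP z := by
  have h := LL.weierstrassPExcept_add 0 z
  rw [← h, wp]
  simp only [ZeroMemClass.coe_zero, sub_zero]
  rw [add_comm]
  congr 1
  · rw [PeriodPair.weierstrassPExcept]
    have e1 := tsum_subtype {l : ℂ | l ∈ Lomega 1 ∧ l ≠ 0} (fun l => 1 / (z - l) ^ 2 - 1 / l ^ 2)
    have e2 := tsum_subtype (LL.lattice : Set ℂ)
      (fun l => if l = 0 then 0 else 1 / (z - l) ^ 2 - 1 / l ^ 2)
    refine e1.trans (Eq.trans ?_ e2.symm)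
    congr 1
    ext l
    by_cases h1 : l ∈ Lomega 1 <;> by_cases h2 : l = 0 <;>
      simp [Set.indicator, mem_LL, h1, h2]
  · simp

lemma scale_mem (ω : ℝ) (hω : 0 < ω) (l : ℂ) : (ω : ℂ) * l ∈ Lomega ω ↔ l ∈ Lomega 1 := by
  have hc : (ω : ℂ) ≠ 0 := by exact_mod_cast hω.ne'
  simp only [Lomega, Set.mem_ofPred_eq]
  refine exists_congr fun m => exists_congr fun n => ?_
  rw [← mul_right_inj' hc (b := l)]
  have : ((ω / Real.sqrt 3 : ℝ) : ℂ) = ω * ((1 / Real.sqrt 3 : ℝ) : ℂ) := by push_cast; ring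
  rw [this]
  constructor <;> intro h <;> rw [h] <;> ring

lemma wp_scale (ω : ℝ) (hω : 0 < ω) (z : ℂ) :
    wp (Lomega ω) (ω * z) = ((ω : ℂ) ^ 2)⁻¹ * wp (Lomega 1) z := by
  have hc : (ω : ℂ) ≠ 0 := by exact_mod_cast hω.ne'
  let e : {l : ℂ // l ∈ Lomega 1 ∧ l ≠ 0} ≃ {l : ℂ // l ∈ Lomega ω ∧ l ≠ 0} :=
    (Equiv.mulLeft₀ (ω : ℂ) hc).subtypeEquiv (by
      intro l
      simp [scale_mem ω hω, hc])
  rw [wp, wp, mul_add, ← e.tsum_eq, ← tsum_mul_left]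
  congr 1
  · rw [mul_pow]; simp [mul_comm]
  · congr 1
    ext l
    have : ((e l : {l : ℂ // l ∈ Lomega ω ∧ l ≠ 0}) : ℂ) = ω * l := rfl
    rw [this, ← mul_sub, mul_pow, mul_pow]
    simp only [one_div, mul_inv]
    ring

lemma g_cont (t : ℝ) (h0 : 0 < t) (h1 : t < 1) :
    ContinuousAt (fun t : ℝ => wp (Lomega 1) (t : ℂ)) t := by
  have : (t : ℂ) ∈ (LL.lattice : Set ℂ)ᶜ := by
    intro h
    obtain ⟨k, hk⟩ := real_mem t ((mem_LL _).1 h)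
    rw [hk] at h0 h1
    norm_cast at h0 h1
    omega
  have hd := (LL.differentiableOn_weierstrassP.differentiableAt
    (LL.isClosed_lattice.isOpen_compl.mem_nhds this)).continuousAt
  simp only [wp_eq]
  exact ContinuousAt.comp (f := fun t : ℝ => (t : ℂ)) hd Complex.continuous_ofReal.continuousAt

lemma g_pole : Tendsto (fun t : ℝ => ((t : ℂ) - 1) ^ 2 * wp (Lomega 1) (t : ℂ)) (𝓝[<] 1) (𝓝 1) := by
  have hm : (1 : ℂ) ∈ LL.lattice := (mem_LL _).2 one_mem
  have hc : ContinuousAt (LL.weierstrassPExcept 1) ((1 : ℝ) : ℂ) := by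
    simpa using (LL.analyticAt_weierstrassPExcept 1).continuousAt
  have hc2 : ContinuousAt (fun t : ℝ => LL.weierstrassPExcept 1 (t : ℂ)) 1 :=
    ContinuousAt.comp (f := fun t : ℝ => (t : ℂ)) hc Complex.continuous_ofReal.continuousAt
  have h3 : ContinuousAt (fun t : ℝ => ((t : ℂ) - 1) ^ 2 *
      (LL.weierstrassPExcept 1 (t : ℂ) - 1) + 1) 1 := by
    have : ContinuousAt (fun t : ℝ => (t : ℂ)) 1 := Complex.continuous_ofReal.continuousAt
    fun_prop
  have h4 := h3.tendsto.mono_left (nhdsWithin_le_nhds (s := Iio 1))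
  simp only [Complex.ofReal_one, sub_self, ne_eq, OfNat.ofNat_ne_zero, not_false_eq_true,
    zero_pow, zero_mul, zero_add] at h4
  refine h4.congr' ?_
  filter_upwards [self_mem_nhdsWithin] with t ht
  rw [wp_eq, ← LL.weierstrassPExcept_add ⟨1, hm⟩]
  have : (t : ℂ) - 1 ≠ 0 := by
    rw [sub_ne_zero]
    exact_mod_cast (ne_of_lt ht)
  field_simp
  ring

lemma g_unbdd (C : ℝ) (hC : ∀ᶠ t : ℝ in 𝓝[<] 1, ‖wp (Lomega 1) (t : ℂ)‖ ≤ C) : False := by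
  have h1 : Tendsto (fun t : ℝ => ((t : ℂ) - 1) ^ 2) (𝓝[<] 1) (𝓝 0) := by
    have : ContinuousAt (fun t : ℝ => ((t : ℂ) - 1) ^ 2) 1 := by fun_prop
    have := this.tendsto.mono_left (nhdsWithin_le_nhds (s := Iio 1))
    simpa using this
  have h2 := h1.zero_mul_isBoundedUnder_le (g := fun t : ℝ => wp (Lomega 1) (t : ℂ))
    ⟨C, by simpa [eventually_map] using hC⟩
  exact zero_ne_one (tendsto_nhds_unique h2 g_pole)

end QHA

/-- If for each `x > 0`, `u x (y) = 6 ℘_{Λ_{ω_x}}(y + 2ω_x/3)` is the strictly increasing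
solution of `u'' = u²`, `u(0) = 0`, `u(x) = 1` on `[0, x]` with `ω x > 0`, then for each
fixed `s ∈ (0,1)`, `x² u_x(sx) → 6 c₁² ℘_{Λ_{ω₁}}(2ω₁/3 + s c₁)` where `c₁ = ω₁/3`. -/
theorem quadratic_hitting_asymptotics
    (ω : ℝ → ℝ) (u : ℝ → ℝ → ℝ)
    (hyp : ∀ x : ℝ, 0 < x →
      0 < ω x ∧
      ContinuousOn (u x) (Icc 0 x) ∧
      StrictMonoOn (u x) (Icc 0 x) ∧
      (∀ y ∈ Ioo 0 x, deriv (deriv (u x)) y = (u x y) ^ 2) ∧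
      u x 0 = 0 ∧ u x x = 1 ∧
      (∀ y ∈ Icc 0 x, ((u x y : ℂ)) =
        6 * wp (Lomega (ω x)) ((y : ℂ) + 2 * ((ω x : ℝ) : ℂ) / 3))) :
    ∀ s : ℝ, s ∈ Ioo (0:ℝ) 1 →
      Tendsto (fun x : ℝ => ((x : ℂ)) ^ 2 * ((u x (s * x) : ℝ) : ℂ)) atTop
        (nhds (6 * (((ω 1 : ℝ) : ℂ) / 3) ^ 2 *
          wp (Lomega (ω 1)) (((2 * ω 1 / 3 + s * (ω 1 / 3) : ℝ) : ℂ)))) := by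
  intro s hs
  -- scaled representation
  have rep : ∀ x : ℝ, 0 < x → ∀ y ∈ Icc 0 x, ((u x y : ℝ) : ℂ) =
      6 * (((ω x : ℂ) ^ 2)⁻¹ * wp (Lomega 1) ((y / ω x + 2 / 3 : ℝ) : ℂ)) := by
    intro x hx y hy
    obtain ⟨hω, -, -, -, -, -, h⟩ := hyp x hx
    rw [h y hy, ← QHA.wp_scale _ hω]
    congr 2
    have hc : (ω x : ℂ) ≠ 0 := by exact_mod_cast hω.ne'
    push_cast
    field_simp
  have hlt : ∀ x : ℝ, 0 < x → x < ω x / 3 := by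
    intro x hx
    by_contra hcon
    push Not at hcon
    obtain ⟨hω, -, hm, -, h0, h1, -⟩ := hyp x hx
    have hc : (ω x : ℂ) ≠ 0 := by exact_mod_cast hω.ne'
    apply QHA.g_unbdd ((ω x) ^ 2)
    have : ∀ᶠ t : ℝ in nhdsWithin 1 (Iio 1), 2 / 3 < t :=
      nhdsWithin_le_nhds (lt_mem_nhds (by norm_num))
    filter_upwards [this, self_mem_nhdsWithin] with t ht1 ht2
    have ht2 : t < 1 := ht2
    have hy : ω x * (t - 2 / 3) ∈ Icc 0 x := by
      constructor
      · apply mul_nonneg hω.le; linarith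
      · nlinarith
    have hr := rep x hx _ hy
    have e : ω x * (t - 2 / 3) / ω x + 2 / 3 = t := by field_simp; ring
    rw [e] at hr
    have hu0 : 0 ≤ u x (ω x * (t - 2 / 3)) := by
      rw [← h0]; exact hm.monotoneOn (left_mem_Icc.2 hx.le) hy hy.1
    have hu1 : u x (ω x * (t - 2 / 3)) ≤ 1 := by
      rw [← h1]; exact hm.monotoneOn hy (right_mem_Icc.2 hx.le) hy.2
    have hg : wp (Lomega 1) (t : ℂ) = ((ω x ^ 2 * u x (ω x * (t - 2 / 3)) / 6 : ℝ) : ℂ) := by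
      push_cast
      rw [hr]
      field_simp
    rw [hg, Complex.norm_real, Real.norm_eq_abs, abs_of_nonneg (by positivity)]
    have := sq_nonneg (ω x)
    nlinarith
  have hr : Tendsto (fun x : ℝ => x / ω x) atTop (nhds (1 / 3)) := by
    rw [tendsto_order]
    constructor
    · intro a ha
      -- bound on compact
      have hco : ContinuousOn (fun t : ℝ => wp (Lomega 1) (t : ℂ)) (Icc (2 / 3) (a + 2 / 3)) := by
        intro t ht
        exact (QHA.g_cont t (by linarith [ht.1]) (by linarith [ht.2])).continuousWithinAt
      obtain ⟨C, hC⟩ := isCompact_Icc.exists_bound_of_continuousOn hco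
      filter_upwards [eventually_gt_atTop 1, eventually_gt_atTop C] with x hx1 hxC
      by_contra hcon
      push Not at hcon
      have hx : 0 < x := by linarith
      obtain ⟨hω, -, hm, -, h0, h1, -⟩ := hyp x hx
      have hc : (ω x : ℂ) ≠ 0 := by exact_mod_cast hω.ne'
      have hp : 0 < x / ω x := by positivity
      have hb := hC (x / ω x + 2 / 3) ⟨by linarith, by linarith⟩
      have hrx := rep x hx x (right_mem_Icc.2 hx.le)
      have hg : wp (Lomega 1) ((x / ω x + 2 / 3 : ℝ) : ℂ) = ((ω x ^ 2 / 6 : ℝ) : ℂ) := by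
        rw [h1] at hrx
        generalize wp (Lomega 1) ((x / ω x + 2 / 3 : ℝ) : ℂ) = w at hrx
        push_cast at hrx ⊢
        field_simp at hrx
        rw [hrx]; ring
      simp only [hg] at hb
      rw [Complex.norm_real, Real.norm_eq_abs, abs_of_nonneg (by positivity)] at hb
      have := hlt x hx
      nlinarith
    · intro a ha
      filter_upwards [eventually_gt_atTop 0] with x hx
      have hω := (hyp x hx).1
      have : x / ω x < 1 / 3 := by
        rw [div_lt_iff₀ hω]; linarith [hlt x hx]
      linarith
  have hω1 := (hyp 1 one_pos).1
  have hc1 : (ω 1 : ℂ) ≠ 0 := by exact_mod_cast hω1.ne'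
  have hlim : 6 * (((ω 1 : ℝ) : ℂ) / 3) ^ 2 *
          wp (Lomega (ω 1)) (((2 * ω 1 / 3 + s * (ω 1 / 3) : ℝ) : ℂ)) =
      6 * (((1 / 3 : ℝ) : ℂ) ^ 2 * wp (Lomega 1) ((s * (1 / 3) + 2 / 3 : ℝ) : ℂ)) := by
    have : (((2 * ω 1 / 3 + s * (ω 1 / 3) : ℝ) : ℂ)) =
      (ω 1 : ℂ) * ((s * (1 / 3) + 2 / 3 : ℝ) : ℂ) := by push_cast; ring
    rw [this, QHA.wp_scale _ hω1]
    generalize wp (Lomega 1) _ = w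
    push_cast
    field_simp
  rw [hlim]
  have ht : Tendsto (fun x : ℝ => s * (x / ω x) + 2 / 3) atTop (nhds (s * (1 / 3) + 2 / 3)) :=
    (hr.const_mul s).add_const _
  have hcg := QHA.g_cont (s * (1 / 3) + 2 / 3) (by linarith [hs.1]) (by linarith [hs.2])
  have hT := ((((Complex.continuous_ofReal.tendsto _).comp hr).pow 2).mul
    (hcg.tendsto.comp ht)).const_mul (6 : ℂ)
  refine hT.congr' ?_
  filter_upwards [eventually_gt_atTop 0] with x hx
  have hω := (hyp x hx).1
  have hc : (ω x : ℂ) ≠ 0 := by exact_mod_cast hω.ne'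
  rw [rep x hx (s * x) ⟨by nlinarith [hs.1], by nlinarith [hs.2]⟩]
  simp only [Function.comp_apply, mul_div_assoc]
  push_cast
  generalize wp (Lomega 1) _ = w
  field_simp
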